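/- Let 𝔛 be a countable set and P : 𝔛 × 𝔛 → [0,1] a loop-free stochastic matrix ((P^k)_{xx} = 0 for all x, k ≥ 1), Q = ∑_{k≥1} P^k, π an initial distribution, (S_0, S_1, …) the associated Markov chain on 𝔛^ℕ, and K_{xy} = π_x + (πQ)_x − Q_{yx}. Let 𝔜 ⊆ 𝔛 be a finite subset such that if Q_{yz} > 0 for some y ∈ 𝔜 and z ∈ 𝔛∖𝔜 then Q_{zy'} = 0 for all y' ∈ 𝔜. Let π̃_y be the probability that the first point of the trajectory {S_m} lying in 𝔜 is y, let π_0 be the probability that the trajectory does not intersect 𝔜, and set P_{y𝓕} = 1 − ∑_{y'∈𝔜} P_{yy'}. If π_0 ≠ 0, then the matrix 1 − K_𝔜 is invertible and L_𝔜 := K_𝔜 (1 − K_𝔜)^{-1} has entries (L_𝔜)_{xy} = π̃_x P_{y𝓕} / π_0 − P_{yx} for x, y ∈ 𝔜. -/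

import Mathlib

open scoped BigOperators
open MeasureTheory

/-- Powers of a (possibly infinite) matrix `P : 𝔛 → 𝔛 → ℝ`. -/
noncomputable def powMat {𝔛 : Type*} [DecidableEq 𝔛] (P : 𝔛 → 𝔛 → ℝ) : ℕ → 𝔛 → 𝔛 → ℝ
  | 0 => fun x y => if x = y then 1 else 0
  | k + 1 => fun x y => ∑' z, powMat P k x z * P z y

/-- `Q x y = ∑_{k=1}^∞ (P^k) x y`. -/
noncomputable def Qmat {𝔛 : Type*} [DecidableEq 𝔛] (P : 𝔛 → 𝔛 → ℝ) (x y : 𝔛) : ℝ :=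
  ∑' k : ℕ, powMat P (k + 1) x y

/-- The correlation kernel `K x y = π x + (πQ) x - Q y x` of Theorem 1.1. -/
noncomputable def Kker {𝔛 : Type*} [DecidableEq 𝔛] (P : 𝔛 → 𝔛 → ℝ) (π : 𝔛 → ℝ)
    (x y : 𝔛) : ℝ :=
  π x + (∑' z, π z * Qmat P z x) - Qmat P y x

open scoped ENNReal

/-- Powers of a matrix with entries in `ℝ≥0∞`. -/
noncomputable def epowMat {𝔛 : Type*} [DecidableEq 𝔛] (p : 𝔛 → 𝔛 → ℝ≥0∞) : ℕ → 𝔛 → 𝔛 → ℝ≥0∞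
  | 0 => fun x y => if x = y then 1 else 0
  | k + 1 => fun x y => ∑' z, epowMat p k x z * p z y

/-- The `ℝ≥0∞`-valued Green matrix `∑_{k ≥ 1} p ^ k`. -/
noncomputable def eQmat {𝔛 : Type*} [DecidableEq 𝔛] (p : 𝔛 → 𝔛 → ℝ≥0∞) (x y : 𝔛) : ℝ≥0∞ :=
  ∑' k : ℕ, epowMat p (k + 1) x y

section Powers

variable {𝔛 : Type*} [DecidableEq 𝔛] {p : 𝔛 → 𝔛 → ℝ≥0∞}

theorem epowMat_zero (p : 𝔛 → 𝔛 → ℝ≥0∞) (x y : 𝔛) :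
    epowMat p 0 x y = if x = y then 1 else 0 := rfl

theorem epowMat_succ (p : 𝔛 → 𝔛 → ℝ≥0∞) (k : ℕ) (x y : 𝔛) :
    epowMat p (k + 1) x y = ∑' z, epowMat p k x z * p z y := rfl

theorem epowMat_one (p : 𝔛 → 𝔛 → ℝ≥0∞) (x y : 𝔛) : epowMat p 1 x y = p x y := by
  rw [epowMat_succ, tsum_eq_single x]
  · simp [epowMat_zero]
  · intro z hz
    simp [epowMat_zero, hz.symm]

theorem epowMat_succ' (p : 𝔛 → 𝔛 → ℝ≥0∞) (k : ℕ) (x y : 𝔛) :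
    epowMat p (k + 1) x y = ∑' z, p x z * epowMat p k z y := by
  induction k generalizing y with
  | zero =>
    rw [epowMat_one, tsum_eq_single y]
    · simp [epowMat_zero]
    · intro z hz
      simp [epowMat_zero, hz]
  | succ k ih =>
    rw [epowMat_succ]
    simp_rw [ih, epowMat_succ p k, ← ENNReal.tsum_mul_right, ← ENNReal.tsum_mul_left]
    rw [ENNReal.tsum_comm]
    simp_rw [mul_assoc]

theorem tsum_epowMat (hp : ∀ x, ∑' y, p x y = 1) (k : ℕ) (x : 𝔛) :
    ∑' y, epowMat p k x y = 1 := by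
  induction k with
  | zero => simp [epowMat_zero]
  | succ k ih =>
    simp_rw [epowMat_succ]
    rw [ENNReal.tsum_comm]
    simp_rw [ENNReal.tsum_mul_left, hp, mul_one, ih]

theorem epowMat_le_one (hp : ∀ x, ∑' y, p x y = 1) (k : ℕ) (x y : 𝔛) :
    epowMat p k x y ≤ 1 :=
  (ENNReal.le_tsum y).trans_eq (tsum_epowMat hp k x)

theorem sum_range_epowMat_le_one (hp : ∀ x, ∑' y, p x y = 1)
    (hloop : ∀ x k, epowMat p (k + 1) x x = 0) (n : ℕ) (x y : 𝔛) :
    ∑ k ∈ Finset.range n, epowMat p k x y ≤ 1 := by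
  induction n generalizing x with
  | zero => simp
  | succ n ih =>
    rw [Finset.sum_range_succ']
    by_cases h : x = y
    · subst h
      simp [hloop, epowMat_zero]
    · simp_rw [epowMat_zero, if_neg h, add_zero, epowMat_succ']
      rw [← Summable.tsum_finsetSum fun _ _ => ENNReal.summable]
      simp_rw [← Finset.mul_sum]
      calc ∑' z, p x z * ∑ k ∈ Finset.range n, epowMat p k z y
          ≤ ∑' z, p x z * 1 := ENNReal.tsum_le_tsum fun z => by gcongr; exact ih z
        _ = 1 := by simp [hp]

theorem eQmat_le_one (hp : ∀ x, ∑' y, p x y = 1)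
    (hloop : ∀ x k, epowMat p (k + 1) x x = 0) (x y : 𝔛) : eQmat p x y ≤ 1 := by
  refine ENNReal.tsum_le_of_sum_range_le fun n => ?_
  refine le_trans ?_ (sum_range_epowMat_le_one hp hloop (n + 1) x y)
  rw [Finset.sum_range_succ']
  exact le_self_add

theorem le_eQmat (p : 𝔛 → 𝔛 → ℝ≥0∞) (x y : 𝔛) : p x y ≤ eQmat p x y := by
  rw [← epowMat_one p x y]
  exact ENNReal.le_tsum (f := fun k => epowMat p (k + 1) x y) 0

theorem epowMat_eq_zero_of_eQmat_eq_zero {x y : 𝔛} (h : eQmat p x y = 0) {k : ℕ} (hk : 0 < k) :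
    epowMat p k x y = 0 := by
  have h' := ENNReal.tsum_eq_zero.1 h (k - 1)
  rwa [Nat.sub_add_cancel hk] at h'

theorem eQmat_eq (p : 𝔛 → 𝔛 → ℝ≥0∞) (x y : 𝔛) :
    eQmat p x y = p x y + ∑' z, eQmat p x z * p z y := by
  unfold eQmat
  rw [tsum_eq_zero_add' ENNReal.summable, zero_add, epowMat_one]
  simp_rw [← ENNReal.tsum_mul_right]
  rw [ENNReal.tsum_comm]
  simp_rw [epowMat_succ p (_ + 1)]

/-- The restriction to a set without returns of the identity `Q = P + Q P`. -/
theorem eQmat_eq_of_noReturn {s : Finset 𝔛}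
    (hs : ∀ y ∈ s, ∀ z ∉ s, eQmat p y z = 0 ∨ ∀ y' ∈ s, eQmat p z y' = 0)
    {x y : 𝔛} (hx : x ∈ s) (hy : y ∈ s) :
    eQmat p x y = p x y + ∑ z ∈ s, eQmat p x z * p z y := by
  rw [eQmat_eq, tsum_eq_sum]
  intro z hz
  rcases hs x hx z hz with h | h
  · rw [h, zero_mul]
  · rw [le_zero_iff.1 ((le_eQmat p z y).trans_eq (h y hy)), mul_zero]

end Powers

section RealPowers

variable {𝔛 : Type*} [DecidableEq 𝔛] {P : 𝔛 → 𝔛 → ℝ}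

theorem tsum_ofReal_eq_one {α : Type*} {f : α → ℝ} (h0 : ∀ a, 0 ≤ f a) (h1 : ∑' a, f a = 1) :
    ∑' a, ENNReal.ofReal (f a) = 1 := by
  have hf : Summable f := by
    by_contra h
    simp [tsum_eq_zero_of_not_summable h] at h1
  rw [← ENNReal.ofReal_tsum_of_nonneg h0 hf, h1, ENNReal.ofReal_one]

theorem toReal_epowMat (hP0 : ∀ x y, 0 ≤ P x y) (hP : ∀ x, ∑' y, P x y = 1) (k : ℕ) (x y : 𝔛) :
    (epowMat (fun x y => ENNReal.ofReal (P x y)) k x y).toReal = powMat P k x y := by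
  induction k generalizing y with
  | zero =>
    rw [epowMat_zero]
    simp only [powMat]
    split_ifs <;> simp
  | succ k ih =>
    rw [epowMat_succ, ENNReal.tsum_toReal_eq]
    · simp only [powMat, ENNReal.toReal_mul, ih, ENNReal.toReal_ofReal (hP0 _ _)]
    · intro z
      refine ENNReal.mul_ne_top (ne_top_of_le_ne_top ENNReal.one_ne_top ?_) ENNReal.ofReal_ne_top
      exact epowMat_le_one (fun x => tsum_ofReal_eq_one (hP0 x) (hP x)) k x z

theorem toReal_eQmat (hP0 : ∀ x y, 0 ≤ P x y) (hP : ∀ x, ∑' y, P x y = 1) (x y : 𝔛) :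
    (eQmat (fun x y => ENNReal.ofReal (P x y)) x y).toReal = Qmat P x y := by
  unfold eQmat Qmat
  rw [ENNReal.tsum_toReal_eq]
  · simp_rw [toReal_epowMat hP0 hP]
  · intro k
    refine ne_top_of_le_ne_top ENNReal.one_ne_top ?_
    exact epowMat_le_one (fun x => tsum_ofReal_eq_one (hP0 x) (hP x)) _ x y

end RealPowers

theorem measurable_initialSegment {𝔛 : Type*} [MeasurableSpace 𝔛] (n : ℕ) :
    Measurable fun (ω : ℕ → 𝔛) (i : Fin (n + 1)) => ω i := by
  fun_prop

section Chain

variable {𝔛 : Type*} [Countable 𝔛] [MeasurableSpace 𝔛] [MeasurableSingletonClass 𝔛]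
  {p : 𝔛 → 𝔛 → ℝ≥0∞} {r : 𝔛 → ℝ≥0∞} {μ : Measure (ℕ → 𝔛)}

/-- Decomposition of an event over the possible initial segments of the trajectory. -/
theorem measure_eq_tsum_initialSegment (n : ℕ) (A : Set (ℕ → 𝔛)) :
    μ A = ∑' f : Fin (n + 1) → 𝔛, μ ({ω | ∀ i : Fin (n + 1), ω i = f i} ∩ A) := by
  have h := tsum_measure_preimage_singleton (μ := μ.restrict A)
    (f := fun (ω : ℕ → 𝔛) (i : Fin (n + 1)) => ω i) (s := Set.univ) Set.countable_univ
    fun y _ => measurable_initialSegment n (measurableSet_singleton y)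
  rw [Set.preimage_univ, Measure.restrict_apply_univ, tsum_univ
    (fun b => μ.restrict A ((fun (ω : ℕ → 𝔛) (i : Fin (n + 1)) => ω i) ⁻¹' {b}))] at h
  rw [← h]
  refine tsum_congr fun f => ?_
  rw [Measure.restrict_apply (measurable_initialSegment n (measurableSet_singleton f))]
  congr 2
  ext ω
  simp [funext_iff]

/-- The Markov property for an event `B` depending only on the coordinates up to `n`. -/
theorem measure_markov
    (hμ : ∀ (n : ℕ) (x : ℕ → 𝔛), μ {ω | ∀ i ≤ n, ω i = x i} =
      r (x 0) * ∏ i ∈ Finset.range n, p (x i) (x (i + 1)))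
    (n : ℕ) (B : Set (ℕ → 𝔛))
    (hB : ∀ ω ω' : ℕ → 𝔛, (∀ i ≤ n, ω i = ω' i) → ω ∈ B → ω' ∈ B) (y x : 𝔛) :
    μ {ω | ω ∈ B ∧ ω n = y ∧ ω (n + 1) = x} = μ {ω | ω ∈ B ∧ ω n = y} * p y x := by
  rw [measure_eq_tsum_initialSegment n, measure_eq_tsum_initialSegment n {ω | ω ∈ B ∧ ω n = y},
    ← ENNReal.tsum_mul_right]
  refine tsum_congr fun f => ?_
  let g : ℕ → 𝔛 := fun i => if h : i ≤ n then f ⟨i, Nat.lt_succ_of_le h⟩ else x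
  have hg : ∀ ω : ℕ → 𝔛, (∀ i : Fin (n + 1), ω i = f i) ↔ ∀ i ≤ n, ω i = g i := by
    intro ω
    constructor
    · intro h i hi
      simpa [g, hi] using h ⟨i, Nat.lt_succ_of_le hi⟩
    · intro h i
      have hi : (i : ℕ) ≤ n := Nat.le_of_lt_succ i.2
      simpa [g, hi] using h i hi
  have hgx : g (n + 1) = x := by simp [g]
  by_cases hgB : g ∈ B ∧ g n = y
  · obtain ⟨hgB, rfl⟩ := hgB
    have h1 : {ω : ℕ → 𝔛 | ∀ i : Fin (n + 1), ω i = f i} ∩ {ω | ω ∈ B ∧ ω n = g n} =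
        {ω | ∀ i ≤ n, ω i = g i} := by
      ext ω
      simp only [Set.mem_inter_iff, Set.mem_ofPred_eq, hg]
      exact ⟨fun h => h.1, fun h => ⟨h, hB g ω (fun i hi => (h i hi).symm) hgB, h n le_rfl⟩⟩
    have h2 : {ω : ℕ → 𝔛 | ∀ i : Fin (n + 1), ω i = f i} ∩
        {ω | ω ∈ B ∧ ω n = g n ∧ ω (n + 1) = x} = {ω | ∀ i ≤ n + 1, ω i = g i} := by
      ext ω
      simp only [Set.mem_inter_iff, Set.mem_ofPred_eq, hg]
      constructor
      · rintro ⟨h, -, -, hx⟩ i hi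
        rcases Nat.lt_or_eq_of_le hi with hi | rfl
        · exact h i (by omega)
        · rw [hx, hgx]
      · intro h
        exact ⟨fun i hi => h i (by omega), hB g ω (fun i hi => (h i (by omega)).symm) hgB,
          h n (by omega), (h _ le_rfl).trans hgx⟩
    rw [h1, h2, hμ, hμ, Finset.prod_range_succ, hgx, mul_assoc]
  · have h1 : {ω : ℕ → 𝔛 | ∀ i : Fin (n + 1), ω i = f i} ∩ {ω | ω ∈ B ∧ ω n = y} = ∅ := by
      ext ω
      simp only [Set.mem_inter_iff, Set.mem_ofPred_eq, hg, Set.mem_empty_iff_false, iff_false]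
      rintro ⟨h, hωB, hy⟩
      exact hgB ⟨hB ω g h hωB, (h n le_rfl).symm.trans hy⟩
    rw [h1, measure_empty, zero_mul]
    refine measure_mono_null ?_ (measure_empty (μ := μ))
    rw [← h1]
    rintro ω ⟨h, hωB, hy, -⟩
    exact ⟨h, hωB, hy⟩

theorem measure_eq_tsum_eval (n : ℕ) (A : Set (ℕ → 𝔛)) :
    μ A = ∑' z, μ {ω | ω ∈ A ∧ ω n = z} := by
  have h := tsum_measure_preimage_singleton (μ := μ.restrict A)
    (f := fun ω : ℕ → 𝔛 => ω n) (s := Set.univ) Set.countable_univ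
    fun y _ => measurable_pi_apply n (measurableSet_singleton y)
  rw [Set.preimage_univ, Measure.restrict_apply_univ, tsum_univ
    (fun b => μ.restrict A ((fun ω : ℕ → 𝔛 => ω n) ⁻¹' {b}))] at h
  rw [← h]
  refine tsum_congr fun z => ?_
  rw [Measure.restrict_apply (measurable_pi_apply n (measurableSet_singleton z)), Set.inter_comm]
  rfl

theorem measure_univ_eq_one_of_cylinder
    (hμ : ∀ (n : ℕ) (x : ℕ → 𝔛), μ {ω | ∀ i ≤ n, ω i = x i} =
      r (x 0) * ∏ i ∈ Finset.range n, p (x i) (x (i + 1)))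
    (hr : ∑' x, r x = 1) : μ Set.univ = 1 := by
  rw [measure_eq_tsum_eval 0, ← hr]
  refine tsum_congr fun z => ?_
  simpa using hμ 0 fun _ => z

theorem measure_step
    (hμ : ∀ (n : ℕ) (x : ℕ → 𝔛), μ {ω | ∀ i ≤ n, ω i = x i} =
      r (x 0) * ∏ i ∈ Finset.range n, p (x i) (x (i + 1)))
    (n : ℕ) (y x : 𝔛) :
    μ {ω | ω n = y ∧ ω (n + 1) = x} = μ {ω | ω n = y} * p y x := by
  simpa using measure_markov hμ n Set.univ (fun _ _ _ _ => Set.mem_univ _) y x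

theorem measurableSet_eval_mem (n : ℕ) (s : Set 𝔛) : MeasurableSet {ω : ℕ → 𝔛 | ω n ∈ s} :=
  measurable_pi_apply n s.to_countable.measurableSet

theorem measurableSet_firstEntrance (s : Finset 𝔛) (m : ℕ) (x : 𝔛) :
    MeasurableSet {ω : ℕ → 𝔛 | ω m = x ∧ ∀ k < m, ω k ∉ s} := by
  have h : {ω : ℕ → 𝔛 | ∀ k < m, ω k ∉ s} = ⋂ k, ⋂ (_ : k < m), {ω | ω k ∈ (s : Set 𝔛)ᶜ} := by
    ext ω
    simp
  have h' : MeasurableSet {ω : ℕ → 𝔛 | ∀ k < m, ω k ∉ s} := by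
    rw [h]
    exact .iInter fun k => .iInter fun _ => measurableSet_eval_mem k (s : Set 𝔛)ᶜ
  exact (measurableSet_eval_mem m {x}).inter h'

theorem measure_firstEntrance {s : Finset 𝔛} {x : 𝔛} (hx : x ∈ s) :
    μ {ω | ∃ m : ℕ, ω m = x ∧ ∀ k < m, ω k ∉ s} =
      ∑' m : ℕ, μ {ω | ω m = x ∧ ∀ k < m, ω k ∉ s} := by
  rw [Set.ofPred_exists, measure_iUnion _ fun m => measurableSet_firstEntrance s m x]
  intro m n hmn
  refine Set.disjoint_left.2 ?_
  rintro ω ⟨h1, h2⟩ ⟨h3, h4⟩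
  rcases lt_or_gt_of_ne hmn with h | h
  · exact h4 m h (h1 ▸ hx)
  · exact h2 n h (h3 ▸ hx)

theorem measure_avoid_add_sum_firstEntrance (s : Finset 𝔛) :
    μ {ω | ∀ m, ω m ∉ s} + ∑ x ∈ s, μ {ω | ∃ m : ℕ, ω m = x ∧ ∀ k < m, ω k ∉ s} =
      μ Set.univ := by
  have hmeas : ∀ x, MeasurableSet {ω : ℕ → 𝔛 | ∃ m : ℕ, ω m = x ∧ ∀ k < m, ω k ∉ s} := by
    intro x
    rw [Set.ofPred_exists]
    exact .iUnion fun m => measurableSet_firstEntrance s m x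
  rw [← measure_biUnion_finset _ fun x _ => hmeas x]
  · have hcompl : {ω : ℕ → 𝔛 | ∀ m, ω m ∉ s} =
        (⋃ x ∈ s, {ω | ∃ m : ℕ, ω m = x ∧ ∀ k < m, ω k ∉ s})ᶜ := by
      ext ω
      simp only [Set.mem_ofPred_eq, Set.mem_compl_iff, Set.mem_iUnion, not_exists]
      constructor
      · rintro h x hx m ⟨rfl, -⟩
        exact h m hx
      · intro h m
        induction m using Nat.strong_induction_on with
        | _ m ih => exact fun hm => h _ hm m ⟨rfl, ih⟩
    rw [hcompl, add_comm]
    exact measure_add_measure_compl (s.measurableSet_biUnion fun x _ => hmeas x)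
  · intro x hx y hy hxy
    refine Set.disjoint_left.2 ?_
    rintro ω ⟨m, hm, hm'⟩ ⟨n, hn, hn'⟩
    rcases lt_trichotomy m n with h | h | h
    · exact hn' m h (hm ▸ hx)
    · subst h
      exact hxy (hm.symm.trans hn)
    · exact hm' n h (hn ▸ hy)

variable [DecidableEq 𝔛]

theorem measure_two_times
    (hμ : ∀ (n : ℕ) (x : ℕ → 𝔛), μ {ω | ∀ i ≤ n, ω i = x i} =
      r (x 0) * ∏ i ∈ Finset.range n, p (x i) (x (i + 1)))
    (m n : ℕ) (y x : 𝔛) :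
    μ {ω | ω m = y ∧ ω (m + n) = x} = μ {ω | ω m = y} * epowMat p n y x := by
  induction n generalizing x with
  | zero =>
    rw [epowMat_zero]
    split_ifs with h
    · subst h
      simp
    · rw [mul_zero]
      refine measure_mono_null ?_ (measure_empty (μ := μ))
      rintro ω ⟨h1, h2⟩
      exact h (h1.symm.trans h2)
  | succ n ih =>
    rw [measure_eq_tsum_eval (m + n), epowMat_succ, ← ENNReal.tsum_mul_left]
    refine tsum_congr fun z => ?_
    rw [← mul_assoc, ← ih]
    have h := measure_markov hμ (m + n) {ω | ω m = y}
      (fun ω ω' h hω => (h m (by omega)).symm.trans hω) z x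
    simp only [Set.mem_ofPred_eq] at h
    rw [← h]
    congr 1
    ext ω
    simp only [Set.mem_ofPred_eq, ← add_assoc]
    tauto

theorem measure_eval
    (hμ : ∀ (n : ℕ) (x : ℕ → 𝔛), μ {ω | ∀ i ≤ n, ω i = x i} =
      r (x 0) * ∏ i ∈ Finset.range n, p (x i) (x (i + 1)))
    (n : ℕ) (x : 𝔛) : μ {ω | ω n = x} = ∑' z, r z * epowMat p n z x := by
  rw [measure_eq_tsum_eval 0]
  refine tsum_congr fun z => ?_
  have h0 : μ {ω | ω 0 = z} = r z := by simpa using hμ 0 fun _ => z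
  rw [← h0, ← measure_two_times hμ, zero_add]
  congr 1
  ext ω
  exact and_comm

/-- The expected number of visits to `x`. -/
theorem tsum_measure_eval
    (hμ : ∀ (n : ℕ) (x : ℕ → 𝔛), μ {ω | ∀ i ≤ n, ω i = x i} =
      r (x 0) * ∏ i ∈ Finset.range n, p (x i) (x (i + 1)))
    (x : 𝔛) : ∑' n, μ {ω | ω n = x} = r x + ∑' z, r z * eQmat p z x := by
  simp_rw [measure_eval hμ]
  rw [tsum_eq_zero_add' ENNReal.summable]
  congr 1
  · rw [tsum_eq_single x]
    · simp [epowMat_zero]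
    · intro z hz
      simp [epowMat_zero, hz]
  · rw [ENNReal.tsum_comm]
    simp_rw [eQmat, ENNReal.tsum_mul_left]

theorem measure_return_eq_zero
    (hμ : ∀ (n : ℕ) (x : ℕ → 𝔛), μ {ω | ∀ i ≤ n, ω i = x i} =
      r (x 0) * ∏ i ∈ Finset.range n, p (x i) (x (i + 1)))
    {s : Finset 𝔛}
    (hs : ∀ y ∈ s, ∀ z ∉ s, eQmat p y z = 0 ∨ ∀ y' ∈ s, eQmat p z y' = 0)
    {k m n : ℕ} (hkm : k < m) (hmn : m < n) :
    μ {ω | ω k ∈ s ∧ ω m ∉ s ∧ ω n ∈ s} = 0 := by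
  obtain ⟨i, rfl⟩ := Nat.exists_eq_add_of_lt hkm
  obtain ⟨j, rfl⟩ := Nat.exists_eq_add_of_lt hmn
  have hsub : {ω : ℕ → 𝔛 | ω k ∈ s ∧ ω (k + i + 1) ∉ s ∧ ω (k + i + 1 + j + 1) ∈ s} ⊆
      ⋃ (y : 𝔛) (z : 𝔛) (y' : 𝔛), {ω | (y ∈ s ∧ z ∉ s ∧ y' ∈ s) ∧
        ω k = y ∧ ω (k + i + 1) = z ∧ ω (k + i + 1 + j + 1) = y'} := by
    intro ω hω
    simp only [Set.mem_iUnion]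
    exact ⟨_, _, _, hω, rfl, rfl, rfl⟩
  refine measure_mono_null hsub ?_
  simp only [measure_iUnion_null_iff]
  intro y z y'
  by_cases h : y ∈ s ∧ z ∉ s ∧ y' ∈ s
  swap
  · simp [h]
  obtain ⟨hy, hz, hy'⟩ := h
  rcases hs y hy z hz with h0 | h0
  · have h1 := measure_two_times hμ k (i + 1) y z
    rw [epowMat_eq_zero_of_eQmat_eq_zero h0 i.succ_pos, mul_zero] at h1
    exact measure_mono_null (by rintro ω ⟨-, h, h', -⟩; exact ⟨h, h'⟩) h1
  · have h1 := measure_two_times hμ (k + i + 1) (j + 1) z y'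
    rw [epowMat_eq_zero_of_eQmat_eq_zero (h0 y' hy') j.succ_pos, mul_zero] at h1
    exact measure_mono_null (by rintro ω ⟨-, -, h, h'⟩; exact ⟨h, h'⟩) h1

theorem measure_visit_eq
    (hμ : ∀ (n : ℕ) (x : ℕ → 𝔛), μ {ω | ∀ i ≤ n, ω i = x i} =
      r (x 0) * ∏ i ∈ Finset.range n, p (x i) (x (i + 1)))
    {s : Finset 𝔛}
    (hs : ∀ y ∈ s, ∀ z ∉ s, eQmat p y z = 0 ∨ ∀ y' ∈ s, eQmat p z y' = 0)
    {x : 𝔛} (hx : x ∈ s) (m : ℕ) :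
    μ {ω | ω (m + 1) = x} = μ {ω | ω (m + 1) = x ∧ ∀ k < m + 1, ω k ∉ s} +
      ∑ y ∈ s, μ {ω | ω m = y} * p y x := by
  rw [← measure_inter_add_sdiff {ω : ℕ → 𝔛 | ω (m + 1) = x}
    (measurableSet_eval_mem m (s : Set 𝔛)), add_comm]
  congr 1
  · refine measure_congr (Filter.EventuallyLE.antisymm ?_ (.of_forall ?_))
    · have hnull : ∀ᵐ ω ∂μ, ∀ k < m, ¬ (ω k ∈ s ∧ ω m ∉ s ∧ ω (m + 1) ∈ s) := by
        rw [ae_all_iff]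
        intro k
        by_cases hk : k < m
        · simp only [hk, forall_true_left]
          rw [ae_iff]
          simpa only [not_not] using measure_return_eq_zero hμ hs hk m.lt_succ_self
        · simp [hk]
      filter_upwards [hnull] with ω hω
      rintro ⟨h1, h2⟩
      refine ⟨h1, fun k hk hks => ?_⟩
      rcases Nat.lt_succ_iff_lt_or_eq.1 hk with hk | rfl
      · exact hω k hk ⟨hks, h2, by rw [show ω (m + 1) = x from h1]; exact hx⟩
      · exact h2 hks
    · rintro ω ⟨h1, h2⟩
      exact ⟨h1, h2 m m.lt_succ_self⟩
  · have hunion : {ω : ℕ → 𝔛 | ω (m + 1) = x} ∩ {ω | ω m ∈ (s : Set 𝔛)} =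
        ⋃ y ∈ s, {ω | ω m = y ∧ ω (m + 1) = x} := by
      ext ω
      simp [and_comm]
    rw [hunion, measure_biUnion_finset]
    · simp_rw [measure_step hμ]
    · intro y _ z _ hyz
      exact Set.disjoint_left.2 fun ω h1 h2 => hyz (h1.1.symm.trans h2.1)
    · intro y _
      exact (measurableSet_eval_mem m {y}).inter (measurableSet_eval_mem (m + 1) {x})

/-- The expected number of visits to a point of a set without returns is the probability of
entering the set there plus the expected number of arrivals from within the set. -/
theorem tsum_measure_eval_eq
    (hμ : ∀ (n : ℕ) (x : ℕ → 𝔛), μ {ω | ∀ i ≤ n, ω i = x i} =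
      r (x 0) * ∏ i ∈ Finset.range n, p (x i) (x (i + 1)))
    {s : Finset 𝔛}
    (hs : ∀ y ∈ s, ∀ z ∉ s, eQmat p y z = 0 ∨ ∀ y' ∈ s, eQmat p z y' = 0)
    {x : 𝔛} (hx : x ∈ s) :
    ∑' n, μ {ω | ω n = x} = μ {ω | ∃ m : ℕ, ω m = x ∧ ∀ k < m, ω k ∉ s} +
      ∑ y ∈ s, (∑' n, μ {ω | ω n = y}) * p y x := by
  rw [measure_firstEntrance hx, tsum_eq_zero_add' ENNReal.summable,
    tsum_eq_zero_add' (f := fun m => μ {ω | ω m = x ∧ ∀ k < m, ω k ∉ s}) ENNReal.summable]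
  simp_rw [measure_visit_eq hμ hs hx, ← ENNReal.tsum_mul_right]
  rw [ENNReal.tsum_add, Summable.tsum_finsetSum fun _ _ => ENNReal.summable, add_assoc]
  simp

end Chain

/-- If `(1 + Q) (1 - p) = 1` and `t = (1 - pᵀ) a`, then the matrix `K x y = a x - Q y x` satisfies
`K (1 - K)⁻¹ = t ⊗ (1 - p 1) / c - pᵀ` where `c = 1 - ∑ t`. -/
theorem isUnit_one_sub_and_mul_inv_of_rank_one {ι : Type*} [Fintype ι] [DecidableEq ι]
    (K p Q : Matrix ι ι ℝ) (a t : ι → ℝ) (c : ℝ)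
    (hK : ∀ x y, K x y = a x - Q y x)
    (hQ : ∀ x y, Q x y = p x y + ∑ z, Q x z * p z y)
    (ha : ∀ x, a x = t x + ∑ y, a y * p y x)
    (hc : c + ∑ x, t x = 1) (hc0 : c ≠ 0) :
    IsUnit (1 - K) ∧ K * (1 - K)⁻¹ =
      Matrix.of fun x y => t x * (1 - ∑ z, p y z) / c - p y x := by
  have hQ' : Q = p + Q * p := by
    ext x y
    simpa [Matrix.mul_apply] using hQ x y
  have h1 : (1 - p.transpose) * (1 + Q.transpose) = 1 := by
    rw [← Matrix.transpose_one, ← Matrix.transpose_sub, ← Matrix.transpose_add,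
      ← Matrix.transpose_mul]
    congr 1
    calc (1 + Q) * (1 - p) = 1 + (Q - (p + Q * p)) := by noncomm_ring
      _ = 1 := by rw [← hQ', sub_self, add_zero]
  have hK' : 1 - K = (1 + Q.transpose) - Matrix.of fun x _ => a x := by
    ext x y
    simp [hK]
    ring
  have h2 : (1 - p.transpose) * (Matrix.of fun x _ => a x) = Matrix.of fun x (_ : ι) => t x := by
    ext x y
    rw [sub_mul, one_mul]
    simp only [Matrix.sub_apply, Matrix.mul_apply, Matrix.of_apply, Matrix.transpose_apply]
    rw [sub_eq_iff_eq_add, ha x]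
    simp_rw [mul_comm]
  have h3 : (1 - p.transpose) * (1 - K) = 1 - Matrix.of fun x (_ : ι) => t x := by
    rw [hK', mul_sub, h1, h2]
  set T : Matrix ι ι ℝ := Matrix.of fun x _ => t x with hT
  have hTT : T * T = (1 - c) • T := by
    ext x y
    simp only [hT, Matrix.mul_apply, Matrix.of_apply, Matrix.smul_apply, smul_eq_mul,
      ← Finset.mul_sum]
    rw [← hc]
    ring
  have h4 : (1 + c⁻¹ • T) * (1 - T) = 1 := by
    rw [add_mul, mul_sub, mul_sub, smul_mul_assoc, smul_mul_assoc, hTT]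
    ext x y
    simp
    field_simp
    ring
  have h5 : ((1 + c⁻¹ • T) * (1 - p.transpose)) * (1 - K) = 1 := by
    rw [mul_assoc, h3, h4]
  refine ⟨IsUnit.of_mul_eq_one_right _ h5, ?_⟩
  rw [Matrix.inv_eq_left_inv h5]
  have h6 := mul_eq_one_comm.1 h5
  have h7 : K * ((1 + c⁻¹ • T) * (1 - p.transpose)) =
      (1 + c⁻¹ • T) * (1 - p.transpose) - 1 := by
    rw [sub_mul, one_mul] at h6
    exact eq_sub_of_add_eq' (sub_eq_iff_eq_add.1 h6).symm
  rw [h7]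
  ext x y
  simp [hT, add_mul, mul_sub, Matrix.mul_apply, ← Finset.mul_sum]
  ring

/-- Second assertion of Theorem 1.3: if the probability `π₀` that the trajectory
avoids the finite no-return window `𝔜` is nonzero, then `1 - K_𝔜` is invertible
and `L_𝔜 = K_𝔜 (1 - K_𝔜)⁻¹` has entries `(L_𝔜) x y = π̃ x * P_{y𝓕} / π₀ - P y x`,
where `π̃ x` is the probability that the trajectory enters `𝔜` first at `x` and
`P_{y𝓕} = 1 - ∑_{y' ∈ 𝔜} P y y'`. -/
theorem L_matrix_of_noReturn_window {𝔛 : Type*} [Countable 𝔛] [DecidableEq 𝔛]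
    [MeasurableSpace 𝔛] [MeasurableSingletonClass 𝔛]
    (P : 𝔛 → 𝔛 → ℝ) (π : 𝔛 → ℝ)
    (hP0 : ∀ x y, 0 ≤ P x y) (hP1 : ∀ x y, P x y ≤ 1)
    (hstoch : ∀ x, ∑' y, P x y = 1)
    (hloop : ∀ (x : 𝔛) (k : ℕ), 1 ≤ k → powMat P k x x = 0)
    (hπ0 : ∀ x, 0 ≤ π x) (hπ1 : ∑' x, π x = 1)
    (μ : Measure (ℕ → 𝔛))
    (hμ : ∀ (n : ℕ) (x : ℕ → 𝔛),
      μ {ω | ∀ i ≤ n, ω i = x i} =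
        ENNReal.ofReal (π (x 0) * ∏ i ∈ Finset.range n, P (x i) (x (i + 1))))
    (𝔜 : Finset 𝔛)
    (hnoreturn : ∀ y ∈ 𝔜, ∀ z ∉ 𝔜, 0 < Qmat P y z → ∀ y' ∈ 𝔜, Qmat P z y' = 0)
    (π₀ : ℝ) (hπ₀ : π₀ = (μ {ω | ∀ m : ℕ, ω m ∉ 𝔜}).toReal) (hπ₀ne : π₀ ≠ 0) :
    IsUnit (1 - Matrix.of fun x y : ↥𝔜 => Kker P π (x : 𝔛) (y : 𝔛)) ∧
    (Matrix.of fun x y : ↥𝔜 => Kker P π (x : 𝔛) (y : 𝔛)) *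
        (1 - Matrix.of fun x y : ↥𝔜 => Kker P π (x : 𝔛) (y : 𝔛))⁻¹ =
      Matrix.of fun x y : ↥𝔜 =>
        (μ {ω | ∃ m : ℕ, ω m = (x : 𝔛) ∧ ∀ k < m, ω k ∉ 𝔜}).toReal *
            (1 - ∑ y' ∈ 𝔜, P (y : 𝔛) y') / π₀
          - P (y : 𝔛) (x : 𝔛) := by

  let p : 𝔛 → 𝔛 → ℝ≥0∞ := fun x y => ENNReal.ofReal (P x y)
  let r : 𝔛 → ℝ≥0∞ := fun x => ENNReal.ofReal (π x)
  have hp : ∀ x, ∑' y, p x y = 1 := fun x => tsum_ofReal_eq_one (hP0 x) (hstoch x)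
  have hr : ∑' x, r x = 1 := tsum_ofReal_eq_one hπ0 hπ1
  have hpow : ∀ k x y, epowMat p k x y = 0 ↔ powMat P k x y = 0 := fun k x y => by
    rw [← toReal_epowMat hP0 hstoch, ENNReal.toReal_eq_zero_iff, or_iff_left]
    exact ne_top_of_le_ne_top ENNReal.one_ne_top (epowMat_le_one hp k x y)
  have hQle : ∀ x y, eQmat p x y ≤ 1 := eQmat_le_one hp fun x k =>
    (hpow _ _ _).2 (hloop x (k + 1) k.succ_pos)
  have hQtop : ∀ x y, eQmat p x y ≠ ∞ := fun x y =>
    ne_top_of_le_ne_top ENNReal.one_ne_top (hQle x y)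
  have hQ : ∀ x y, (eQmat p x y).toReal = Qmat P x y := toReal_eQmat hP0 hstoch
  have hs : ∀ y ∈ 𝔜, ∀ z ∉ 𝔜, eQmat p y z = 0 ∨ ∀ y' ∈ 𝔜, eQmat p z y' = 0 := by
    intro y hy z hz
    refine or_iff_not_imp_left.2 fun h y' hy' => ?_
    have h' := hnoreturn y hy z hz (hQ y z ▸ ENNReal.toReal_pos h (hQtop y z)) y' hy'
    rw [← hQ, ENNReal.toReal_eq_zero_iff] at h'
    exact h'.resolve_right (hQtop z y')
  have hcyl : ∀ (n : ℕ) (x : ℕ → 𝔛), μ {ω | ∀ i ≤ n, ω i = x i} =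
      r (x 0) * ∏ i ∈ Finset.range n, p (x i) (x (i + 1)) := by
    intro n x
    rw [hμ, ENNReal.ofReal_mul (hπ0 _), ENNReal.ofReal_prod_of_nonneg fun _ _ => hP0 _ _]
  have hμ1 : μ Set.univ = 1 := measure_univ_eq_one_of_cylinder hcyl hr
  have : IsProbabilityMeasure μ := ⟨hμ1⟩
  have hvisit := tsum_measure_eval hcyl
  have hrQ : ∀ x, ∑' z, r z * eQmat p z x ≠ ∞ := fun x => by
    refine ne_top_of_le_ne_top ENNReal.one_ne_top ?_
    calc ∑' z, r z * eQmat p z x ≤ ∑' z, r z * 1 :=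
          ENNReal.tsum_le_tsum fun z => by gcongr; exact hQle z x
      _ = 1 := by simp [hr]
  have hvisit_top : ∀ x, ∑' n, μ {ω | ω n = x} ≠ ∞ := fun x => by
    rw [hvisit]
    exact ENNReal.add_ne_top.2 ⟨ENNReal.ofReal_ne_top, hrQ x⟩
  have hvisit_real : ∀ x, (∑' n, μ {ω | ω n = x}).toReal = π x + ∑' z, π z * Qmat P z x :=
    fun x => by
      rw [hvisit, ENNReal.toReal_add ENNReal.ofReal_ne_top (hrQ x), ENNReal.tsum_toReal_eq
        fun z => ENNReal.mul_ne_top ENNReal.ofReal_ne_top (hQtop z x)]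
      simp only [ENNReal.toReal_mul, hQ, ENNReal.toReal_ofReal (hπ0 _)]
  have key := isUnit_one_sub_and_mul_inv_of_rank_one
    (Matrix.of fun x y : 𝔜 => Kker P π (x : 𝔛) (y : 𝔛))
    (Matrix.of fun x y : 𝔜 => P (x : 𝔛) (y : 𝔛))
    (Matrix.of fun x y : 𝔜 => Qmat P (x : 𝔛) (y : 𝔛))
    (fun x => (∑' n, μ {ω | ω n = (x : 𝔛)}).toReal)
    (fun x => (μ {ω | ∃ m : ℕ, ω m = (x : 𝔛) ∧ ∀ k < m, ω k ∉ 𝔜}).toReal) π₀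
    (fun x y => by simp only [Matrix.of_apply, Kker, hvisit_real])
    (fun x y => by
      have h := congrArg ENNReal.toReal (eQmat_eq_of_noReturn hs x.2 y.2)
      have hmul : ∀ z ∈ 𝔜, eQmat p x z * p z y ≠ ∞ := fun z _ =>
        ENNReal.mul_ne_top (hQtop _ _) ENNReal.ofReal_ne_top
      rw [ENNReal.toReal_add ENNReal.ofReal_ne_top (ENNReal.sum_ne_top.2 hmul),
        ENNReal.toReal_sum hmul] at h
      simp only [p, ENNReal.toReal_mul, ENNReal.toReal_ofReal (hP0 _ _)] at h
      simp only [Matrix.of_apply]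
      rw [Finset.sum_coe_sort 𝔜 fun z => Qmat P x z * P z y]
      simpa only [p, ← hQ] using h)
    (fun x => by
      have h := congrArg ENNReal.toReal (tsum_measure_eval_eq hcyl hs x.2)
      have hmul : ∀ y ∈ 𝔜, (∑' n, μ {ω | ω n = y}) * p y x ≠ ∞ := fun y _ =>
        ENNReal.mul_ne_top (hvisit_top y) ENNReal.ofReal_ne_top
      rw [ENNReal.toReal_add (measure_ne_top _ _) (ENNReal.sum_ne_top.2 hmul),
        ENNReal.toReal_sum hmul] at h
      simp only [p, ENNReal.toReal_mul, ENNReal.toReal_ofReal (hP0 _ _)] at h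
      simp only [Matrix.of_apply]
      rw [Finset.sum_coe_sort 𝔜 fun y => (∑' n, μ {ω | ω n = y}).toReal * P y x]
      exact h)
    (by
      have h := congrArg ENNReal.toReal (measure_avoid_add_sum_firstEntrance (μ := μ) 𝔜)
      have hne : ∀ x ∈ 𝔜, μ {ω | ∃ m : ℕ, ω m = x ∧ ∀ k < m, ω k ∉ 𝔜} ≠ ∞ := fun x _ =>
        measure_ne_top _ _
      rw [ENNReal.toReal_add (measure_ne_top _ _) (ENNReal.sum_ne_top.2 hne),
        ENNReal.toReal_sum hne, hμ1, ENNReal.toReal_one, ← hπ₀] at h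
      rw [Finset.sum_coe_sort 𝔜 fun x =>
        (μ {ω | ∃ m : ℕ, ω m = x ∧ ∀ k < m, ω k ∉ 𝔜}).toReal]
      exact h)
    hπ₀ne
  refine ⟨key.1, key.2.trans ?_⟩
  ext x y
  simp only [Matrix.of_apply]
  rw [Finset.sum_coe_sort 𝔜 fun z => P y z]
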